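/- arXiv:1107.5370 — 4 statements merged into one kernel-verified Lean document; each statement's English description precedes it below -/
import Mathlib

section
/- Let G be a multigraph, let u₀ be a vertex of G, let u₁, u₂ be two distinct neighbors of u₀, and let H be the multigraph obtained from G by deleting all edges with one end u₀ and the other end u₁ or u₂. Let κ be a k-edge-coloring of H. For i = 1, 2 let mᵢ be the multiplicity of u₀uᵢ in G, and for i = 0, 1, 2 let Sᵢ be the set of colors seen by uᵢ under κ. If m₁ + |S₀ ∪ S₁| ≤ k, m₂ + |S₀ ∪ S₂| ≤ k, and m₁ + m₂ + |S₀ ∪ (S₁ ∩ S₂)| ≤ k, then κ can be extended to a k-edge-coloring of G, i.e., there is a k-edge-coloring of G whose color classes restricted to the edges of H agree with those of κ. -/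
open Finset

/-- A multigraph on vertex set `V` given by a symmetric multiplicity function
with zero diagonal. -/
def IsMultigraph {V : Type} (m : V → V → ℕ) : Prop :=
  (∀ u v, m u v = m v u) ∧ (∀ v, m v v = 0)

/-- `c` is a `k`-edge-coloring of the multigraph `m`: a decomposition of `m`
into `k` matchings. -/
def IsEdgeColoring {V : Type} [Fintype V] (m : V → V → ℕ)
    (k : ℕ) (c : Fin k → V → V → ℕ) : Prop :=
  (∀ i u v, c i u v ≤ 1) ∧
  (∀ i u v, c i u v = c i v u) ∧
  (∀ i v, c i v v = 0) ∧
  (∀ u v, m u v = ∑ i, c i u v) ∧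
  (∀ i v, ∑ u, c i v u ≤ 1)

/-- The set of colors seen by a vertex `w` under the coloring `c`. -/
def seenColors {V : Type} [Fintype V] {k : ℕ}
    (c : Fin k → V → V → ℕ) (w : V) : Finset (Fin k) :=
  Finset.univ.filter fun i => ∃ x, c i w x = 1

/-- Two finite sets have disjoint subsets of prescribed sizes as soon as Hall's condition holds. -/
theorem exists_disjoint_subsets_card_eq {α : Type*} [DecidableEq α] {B₁ B₂ : Finset α} {a b : ℕ}
    (h₁ : a ≤ #B₁) (h₂ : b ≤ #B₂) (h₁₂ : a + b ≤ #(B₁ ∪ B₂)) :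
    ∃ A₁ ⊆ B₁, ∃ A₂ ⊆ B₂, Disjoint A₁ A₂ ∧ #A₁ = a ∧ #A₂ = b := by
  rcases le_total a #(B₁ \ B₂) with h | h
  · obtain ⟨A₁, hA₁, rfl⟩ := exists_subset_card_eq h
    obtain ⟨A₂, hA₂, rfl⟩ := exists_subset_card_eq h₂
    exact ⟨A₁, hA₁.trans sdiff_subset, A₂, hA₂,
      disjoint_of_subset_left hA₁ (disjoint_of_subset_right hA₂ sdiff_disjoint), rfl, rfl⟩
  · obtain ⟨A₁, hBA, hA₁, rfl⟩ := exists_subsuperset_card_eq sdiff_subset h h₁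
    have hsub : B₁ ∪ B₂ ⊆ A₁ ∪ (B₂ \ A₁) := by
      intro x hx
      have := @hBA x
      simp only [mem_union, mem_sdiff] at *
      tauto
    have hcard := (card_le_card hsub).trans (card_union_le _ _)
    obtain ⟨A₂, hA₂, rfl⟩ := exists_subset_card_eq (show b ≤ #(B₂ \ A₁) by omega)
    exact ⟨A₁, hA₁, A₂, hA₂.trans sdiff_subset,
      disjoint_of_subset_right hA₂ disjoint_sdiff, rfl, rfl⟩

theorem eq_zero_of_notMem_seenColors {V : Type} [Fintype V] {k : ℕ}
    {m : V → V → ℕ} {c : Fin k → V → V → ℕ}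
    (hc : IsEdgeColoring m k c) {i : Fin k} {w : V} (hi : i ∉ seenColors c w) (v : V) :
    c i w v = 0 := by
  have h : c i w v ≠ 1 := fun h => hi (by simpa [seenColors] using ⟨v, h⟩)
  have := hc.1 i w v
  omega

section AddEdges

variable {V : Type} [DecidableEq V] {k : ℕ}

/-- Add to the coloring `c` one edge between `x` and `y` of each color in `A`. -/
def addEdges (c : Fin k → V → V → ℕ) (A : Finset (Fin k)) (x y : V) : Fin k → V → V → ℕ :=
  fun i u v => c i u v + if i ∈ A ∧ ((u = x ∧ v = y) ∨ (u = y ∧ v = x)) then 1 else 0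

theorem addEdges_of_ne (c : Fin k → V → V → ℕ) (A : Finset (Fin k)) {x y u v : V}
    (h : ¬((u = x ∧ v = y) ∨ (u = y ∧ v = x))) (i : Fin k) :
    addEdges c A x y i u v = c i u v := by
  simp [addEdges, h]

variable [Fintype V]

theorem seenColors_addEdges_subset (c : Fin k → V → V → ℕ) (A : Finset (Fin k)) (x y w : V) :
    seenColors (addEdges c A x y) w ⊆ seenColors c w ∪ A := by
  intro i hi
  by_cases hA : i ∈ A
  · exact mem_union_right _ hA
  · apply mem_union_left
    obtain ⟨v, hv⟩ := (mem_filter.1 hi).2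
    exact mem_filter.2 ⟨mem_univ i, v, by simpa [addEdges, hA] using hv⟩

theorem seenColors_addEdges_of_ne (c : Fin k → V → V → ℕ) (A : Finset (Fin k)) {x y w : V}
    (hx : w ≠ x) (hy : w ≠ y) : seenColors (addEdges c A x y) w = seenColors c w := by
  simp [seenColors, addEdges, hx, hy]

theorem IsEdgeColoring.addEdges {m : V → V → ℕ} {c : Fin k → V → V → ℕ}
    (hc : IsEdgeColoring m k c) {A : Finset (Fin k)} {x y : V} (hxy : x ≠ y)
    (hx : Disjoint A (seenColors c x)) (hy : Disjoint A (seenColors c y)) :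
    IsEdgeColoring
      (fun u v => m u v + if (u = x ∧ v = y) ∨ (u = y ∧ v = x) then #A else 0) k
      (addEdges c A x y) := by
  have hx0 : ∀ i ∈ A, ∀ v, c i x v = 0 := fun i hi =>
    eq_zero_of_notMem_seenColors hc (disjoint_left.1 hx hi)
  have hy0 : ∀ i ∈ A, ∀ v, c i y v = 0 := fun i hi =>
    eq_zero_of_notMem_seenColors hc (disjoint_left.1 hy hi)
  obtain ⟨hle, hsymm, hdiag, hsum, hmatch⟩ := hc
  refine ⟨fun i u v => ?_, fun i u v => ?_, fun i v => ?_, fun u v => ?_, fun i v => ?_⟩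
  · unfold _root_.addEdges
    split_ifs with h
    · rcases h with ⟨hi, ⟨rfl, rfl⟩ | ⟨rfl, rfl⟩⟩
      · simp [hx0 i hi]
      · simp [hy0 i hi]
    · simpa using hle i u v
  · simp only [_root_.addEdges, hsymm i u v]
    congr 1
    exact if_congr (by tauto) rfl rfl
  · rw [addEdges_of_ne _ _ (by grind), hdiag]
  · by_cases h : (u = x ∧ v = y) ∨ (u = y ∧ v = x)
    · simp [_root_.addEdges, h, hsum u v, sum_add_distrib]
    · simp [_root_.addEdges, h, hsum u v]
  · by_cases hi : i ∈ A
    · by_cases hvx : v = x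
      · subst hvx
        simp [_root_.addEdges, hi, hx0 i hi, hxy]
      · by_cases hvy : v = y
        · subst hvy
          simp [_root_.addEdges, hi, hy0 i hi, hvx]
        · simpa [_root_.addEdges, hvx, hvy] using hmatch i v
    · simpa [_root_.addEdges, hi] using hmatch i v

end AddEdges

/-- **Lemma 4** (coloring extension lemma).  Let `u₀` be a vertex with distinct
neighbors `u₁, u₂`, let `H` be obtained from `G` by deleting all edges between
`u₀` and `u₁` or `u₂`, and let `κ = c` be a `k`-edge-coloring of `H`.  If
`m₁ + |S₀ ∪ S₁| ≤ k`, `m₂ + |S₀ ∪ S₂| ≤ k` and `m₁ + m₂ + |S₀ ∪ (S₁ ∩ S₂)| ≤ k`,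
then `κ` extends to a `k`-edge-coloring of `G`. -/
theorem coloring_extension {V : Type} [Fintype V] [DecidableEq V]
    (m : V → V → ℕ) (hm : IsMultigraph m)
    (u₀ u₁ u₂ : V) (hne : u₁ ≠ u₂) (hne₁ : u₁ ≠ u₀) (hne₂ : u₂ ≠ u₀)
    (hadj₁ : 0 < m u₀ u₁) (hadj₂ : 0 < m u₀ u₂)
    (k : ℕ) (c : Fin k → V → V → ℕ)
    (hc : IsEdgeColoring
      (fun u v => if (u = u₀ ∧ (v = u₁ ∨ v = u₂)) ∨ (v = u₀ ∧ (u = u₁ ∨ u = u₂))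
        then 0 else m u v) k c)
    (h₁ : m u₀ u₁ + (seenColors c u₀ ∪ seenColors c u₁).card ≤ k)
    (h₂ : m u₀ u₂ + (seenColors c u₀ ∪ seenColors c u₂).card ≤ k)
    (h₁₂ : m u₀ u₁ + m u₀ u₂ +
      (seenColors c u₀ ∪ (seenColors c u₁ ∩ seenColors c u₂)).card ≤ k) :
    ∃ c' : Fin k → V → V → ℕ, IsEdgeColoring m k c' ∧
      ∀ i u v, ¬ ((u = u₀ ∧ (v = u₁ ∨ v = u₂)) ∨ (v = u₀ ∧ (u = u₁ ∨ u = u₂))) →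
        c' i u v = c i u v := by
  obtain ⟨A₁, hA₁, A₂, hA₂, hdisj, hcard₁, hcard₂⟩ :
      ∃ A₁ ⊆ (seenColors c u₀ ∪ seenColors c u₁)ᶜ, ∃ A₂ ⊆ (seenColors c u₀ ∪ seenColors c u₂)ᶜ,
        Disjoint A₁ A₂ ∧ #A₁ = m u₀ u₁ ∧ #A₂ = m u₀ u₂ := by
    apply exists_disjoint_subsets_card_eq
    · rw [card_compl, Fintype.card_fin]
      omega
    · rw [card_compl, Fintype.card_fin]
      omega
    · rw [← compl_inter, ← union_inter_distrib_left, card_compl, Fintype.card_fin]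
      omega
  rw [subset_compl_iff_disjoint_right, disjoint_union_right] at hA₁ hA₂
  have hc₁ := hc.addEdges hne₁.symm hA₁.1 hA₁.2
  have hc₂ := hc₁.addEdges (A := A₂) hne₂.symm
    (disjoint_of_subset_right (seenColors_addEdges_subset c A₁ u₀ u₁ u₀)
      (disjoint_union_right.2 ⟨hA₂.1, hdisj.symm⟩))
    (by rw [seenColors_addEdges_of_ne c A₁ hne₂ hne.symm]; exact hA₂.2)
  refine ⟨addEdges (addEdges c A₁ u₀ u₁) A₂ u₀ u₂, ?_, fun i u v h => ?_⟩
  · convert hc₂ using 1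
    funext u v
    have := hm.1 u v
    grind
  · rw [addEdges_of_ne _ _ (by tauto), addEdges_of_ne _ _ (by tauto)]
end

section
/- Let k be an integer and let G be a multigraph with Δ(G) ≤ k. Then Γ(G) ≤ k if and only if 2|E(G[U])| ≤ k(|U|−1) for every set U of vertices such that |U| is odd, |U| ≥ 3, and every vertex of U has at least two neighbors in U (i.e., the underlying simple graph of G[U] has no vertex of degree at most one). -/
open Finset

/-- The degree of a vertex in the multigraph `m`. -/
def mgDegree {V : Type} [Fintype V] (m : V → V → ℕ) (v : V) : ℕ := ∑ u, m v u

/-- The maximum degree `Δ` of the multigraph `m` (0 for the empty graph). -/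
def mgMaxDegree {V : Type} [Fintype V] (m : V → V → ℕ) : ℕ :=
  Finset.univ.sup (mgDegree m)

/-- `Γ(G) = max{2|E(G[U])|/(|U|-1) : U ⊆ V, |U| odd, |U| ≥ 3}` (0 if there is no
such `U`); note that `∑_{u,v ∈ U} m u v = 2|E(G[U])|`. -/
def mgGamma {V : Type} [Fintype V] [DecidableEq V] (m : V → V → ℕ) : ℚ :=
  (Finset.univ.powerset.filter fun U : Finset V => Odd U.card ∧ 3 ≤ U.card).fold
    max 0 (fun U => (∑ u ∈ U, ∑ v ∈ U, (m u v : ℚ)) / (U.card - 1))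

/-- Adding a vertex `w` to `T` adds twice the number of edges between `w` and `T` to the
degree sum of the induced subgraph. -/
lemma IsMultigraph.sum_insert_insert {V : Type} [DecidableEq V] {m : V → V → ℕ}
    (hm : IsMultigraph m) {w : V} {T : Finset V} (hw : w ∉ T) :
    ∑ u ∈ insert w T, ∑ v ∈ insert w T, (m u v : ℤ) =
      ∑ u ∈ T, ∑ v ∈ T, (m u v : ℤ) + 2 * ∑ v ∈ T, (m w v : ℤ) := by
  simp only [Finset.sum_insert hw, Finset.sum_add_distrib, hm.2 w, hm.1 _ w]
  push_cast
  ring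

lemma sum_le_mgMaxDegree {V : Type} [Fintype V] (m : V → V → ℕ) (w : V) (T : Finset V) :
    ∑ v ∈ T, m w v ≤ mgMaxDegree m :=
  (Finset.sum_le_univ_sum_of_nonneg fun _ => Nat.zero_le _).trans
    (Finset.le_sup (f := mgDegree m) (Finset.mem_univ w))

lemma mgGamma_le_iff_forall_odd {V : Type} [Fintype V] [DecidableEq V] (m : V → V → ℕ)
    {k : ℤ} (hk : 0 ≤ k) :
    mgGamma m ≤ (k : ℚ) ↔ ∀ U : Finset V, Odd U.card → 3 ≤ U.card →
      (∑ u ∈ U, ∑ v ∈ U, (m u v : ℤ)) ≤ k * ((U.card : ℤ) - 1) := by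
  have hk' : (0 : ℚ) ≤ k := by exact_mod_cast hk
  simp only [mgGamma, Finset.fold_max_le, hk', true_and, Finset.mem_filter, Finset.mem_powerset,
    Finset.subset_univ, and_imp]
  refine forall_congr' fun U => imp_congr_right fun _ => imp_congr_right fun hU => ?_
  have hpos : (0 : ℚ) < U.card - 1 := by
    have : (3 : ℚ) ≤ U.card := by exact_mod_cast hU
    linarith
  rw [div_le_iff₀ hpos]
  exact_mod_cast Iff.rfl

/-- If the edge bound holds for odd sets inducing no vertex with at most one neighbor, then it
holds for all odd sets: a vertex with at most one neighbor can be removed together with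
a vertex containing all its neighbors. -/
lemma IsMultigraph.sum_le_of_forall_two_neighbors {V : Type} [Fintype V] [DecidableEq V]
    {m : V → V → ℕ} (hm : IsMultigraph m) {k : ℤ} (hΔ : (mgMaxDegree m : ℤ) ≤ k)
    (h : ∀ U : Finset V, Odd U.card → 3 ≤ U.card →
      (∀ u ∈ U, 2 ≤ (U.filter fun v => v ≠ u ∧ 0 < m u v).card) →
      (∑ u ∈ U, ∑ v ∈ U, (m u v : ℤ)) ≤ k * ((U.card : ℤ) - 1))
    (U : Finset V) (hodd : Odd U.card) :
    (∑ u ∈ U, ∑ v ∈ U, (m u v : ℤ)) ≤ k * ((U.card : ℤ) - 1) := by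
  induction U using Finset.strongInduction with
  | H U ih =>
  obtain h1 | h3 : U.card = 1 ∨ 3 ≤ U.card := by
    obtain ⟨r, hr⟩ := hodd
    omega
  · obtain ⟨a, rfl⟩ := Finset.card_eq_one.mp h1
    simp [hm.2]
  by_cases hU : ∀ u ∈ U, 2 ≤ (U.filter fun v => v ≠ u ∧ 0 < m u v).card
  · exact h U hodd h3 hU
  push Not at hU
  obtain ⟨u, hu, hlt⟩ := hU
  obtain ⟨w, hw, hnb⟩ : ∃ w ∈ U.erase u, ∀ v ∈ U, v ≠ w → m u v = 0 := by
    obtain hN | ⟨w, hwN⟩ :=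
      (U.filter fun v => v ≠ u ∧ 0 < m u v).eq_empty_or_nonempty
    · obtain ⟨w, hw⟩ : (U.erase u).Nonempty := by
        rw [← Finset.card_pos, Finset.card_erase_of_mem hu]
        omega
      refine ⟨w, hw, fun v hv _ => ?_⟩
      by_contra hne
      have hvu : v ≠ u := fun e => hne (e ▸ hm.2 u)
      exact Finset.eq_empty_iff_forall_notMem.mp hN v
        (Finset.mem_filter.mpr ⟨hv, hvu, Nat.pos_of_ne_zero hne⟩)
    · have hw := Finset.mem_filter.mp hwN
      refine ⟨w, Finset.mem_erase.mpr ⟨hw.2.1, hw.1⟩, fun v hv hvw => ?_⟩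
      by_contra hne
      have hvu : v ≠ u := fun e => hne (e ▸ hm.2 u)
      exact hvw (Finset.card_le_one.mp (Nat.le_of_lt_succ hlt) v
        (Finset.mem_filter.mpr ⟨hv, hvu, Nat.pos_of_ne_zero hne⟩) w hwN)
  obtain ⟨W, huW, hwW, rfl⟩ : ∃ W, u ∉ W ∧ w ∉ insert u W ∧ U = insert w (insert u W) := by
    refine ⟨(U.erase u).erase w, by simp, by simp [Finset.ne_of_mem_erase hw], ?_⟩
    rw [Finset.insert_comm, Finset.insert_erase hw, Finset.insert_erase hu]
  have hcard : (insert w (insert u W)).card = W.card + 2 := by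
    rw [Finset.card_insert_of_notMem hwW, Finset.card_insert_of_notMem huW]
  have hWlt : W ⊂ insert w (insert u W) :=
    (Finset.ssubset_insert huW).trans (Finset.ssubset_insert hwW)
  have hWodd : Odd W.card := by
    rw [hcard] at hodd
    exact (Nat.odd_add.mp hodd).mpr even_two
  have hu0 : ∑ v ∈ W, (m u v : ℤ) = 0 :=
    Finset.sum_eq_zero fun v hv => by
      rw [hnb v (hWlt.subset hv) fun e => hwW (Finset.mem_insert_of_mem (e ▸ hv)), Nat.cast_zero]
  have hdeg : ∑ v ∈ insert u W, (m w v : ℤ) ≤ k :=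
    le_trans (by exact_mod_cast sum_le_mgMaxDegree m w (insert u W)) hΔ
  have hW := ih W hWlt hWodd
  rw [hm.sum_insert_insert hwW, hm.sum_insert_insert huW, hu0, hcard]
  push_cast
  linarith

/-- **Lemma 5**: if `Δ(G) ≤ k`, then `Γ(G) ≤ k` if and only if
`2|E(G[U])| ≤ k(|U|-1)` for every odd set `U` with `|U| ≥ 3` in which every
vertex has at least two neighbors (i.e. the underlying simple graph of `G[U]`
has no vertex of degree at most one).  Here `∑_{u,v ∈ U} m u v = 2|E(G[U])|`. -/
theorem gamma_le_iff {V : Type} [Fintype V] [DecidableEq V]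
    (m : V → V → ℕ) (hm : IsMultigraph m) (k : ℤ)
    (hΔ : (mgMaxDegree m : ℤ) ≤ k) :
    mgGamma m ≤ (k : ℚ) ↔
      ∀ U : Finset V, Odd U.card → 3 ≤ U.card →
        (∀ u ∈ U, 2 ≤ (U.filter fun v => v ≠ u ∧ 0 < m u v).card) →
        (∑ u ∈ U, ∑ v ∈ U, (m u v : ℤ)) ≤ k * ((U.card : ℤ) - 1) := by
  rw [mgGamma_le_iff_forall_odd m ((Nat.cast_nonneg _).trans hΔ)]
  exact ⟨fun h U hodd h3 _ => h U hodd h3,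
    fun h U hodd _ => hm.sum_le_of_forall_two_neighbors hΔ h U hodd⟩
end

section
/- Every non-null simple series-parallel graph G has one of the following: (a) a vertex of degree at most one; (b) two distinct vertices of degree two with the same (two-element) neighborhood; (c) two distinct vertices u, v and two not necessarily distinct vertices w, z ∈ V(G) \ {u, v} such that the neighbors of v are exactly u and w, and every neighbor of u is equal to v, w, or z; or (d) five distinct vertices v₁, v₂, u₁, u₂, w such that the neighbors of w are exactly u₁, u₂, v₁, v₂, and for i = 1, 2 the neighbors of vᵢ are exactly w and uᵢ. -/
open Finset

/-- A simple graph has a `K₄` minor iff there are four disjoint nonempty connected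
branch sets, pairwise joined by an edge. -/
def HasK4Minor {V : Type} (G : SimpleGraph V) : Prop :=
  ∃ S : Fin 4 → Set V,
    (∀ i, (S i).Nonempty) ∧
    (∀ i j, i ≠ j → Disjoint (S i) (S j)) ∧
    (∀ i, (SimpleGraph.induce (S i) G).Connected) ∧
    (∀ i j, i ≠ j → ∃ u ∈ S i, ∃ v ∈ S j, G.Adj u v)

/-- A simple graph is series-parallel iff it has no subgraph isomorphic to a
subdivision of `K₄`; equivalently, it has no `K₄` minor. -/
def SeriesParallel {V : Type} (G : SimpleGraph V) : Prop := ¬ HasK4Minor G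

namespace SimpleGraph

variable {V W : Type}

theorem induce_insert_connected {G : SimpleGraph V} {C : Set V} (hC : (G.induce C).Connected)
    {c w : V} (hc : c ∈ C) (h : G.Adj c w) : (G.induce (insert w C)).Connected := by
  have key := induce_union_connected hC.preconnected
    (induce_pair_connected_of_adj h).preconnected ⟨c, hc, by simp⟩
  have heq : C ∪ {c, w} = insert w C := by
    ext x
    simp only [Set.mem_union, Set.mem_insert_iff, Set.mem_singleton_iff]
    grind
  rwa [heq] at key

theorem induce_singleton_connected (G : SimpleGraph V) (v : V) :
    (G.induce {v}).Connected := by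
  rw [induce_singleton_eq_top]
  exact connected_top

/-- If every vertex of a nonempty set `N` has two neighbors in `N`, then `N` contains three
pairwise adjacent disjoint branch sets, two of which are single vertices. -/
theorem exists_triangle_branchSets [Finite V] (G : SimpleGraph V) {N : Set V} (hN : N.Nonempty)
    (hdeg : ∀ v ∈ N, ∀ a, ∃ c ∈ N, G.Adj v c ∧ c ≠ a) :
    ∃ (B : Set V) (w w' : V), B ⊆ N ∧ (G.induce B).Connected ∧ w ∈ N ∧ w' ∈ N ∧
      w ∉ B ∧ w' ∉ B ∧ G.Adj w w' ∧ (∃ b ∈ B, G.Adj b w) ∧ ∃ b ∈ B, G.Adj b w' := by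
  let P : Set (Set V) := {B | B ⊆ N ∧ (G.induce B).Connected ∧
    (∃ e ∈ N, e ∉ B ∧ ∃ b ∈ B, G.Adj b e) ∧
    ∀ v ∈ N, v ∉ B → (∃ b ∈ B, G.Adj b v) → ∃ c ∈ N, G.Adj v c ∧ c ∉ B}
  have hP : P.Nonempty := by
    obtain ⟨a, ha⟩ := hN
    obtain ⟨e, heN, hae, -⟩ := hdeg a ha a
    refine ⟨{a}, by simpa using ha, G.induce_singleton_connected a,
      ⟨e, heN, by simpa using hae.ne', a, rfl, hae⟩, fun v hv _ _ => ?_⟩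
    obtain ⟨c, hc, hvc, hca⟩ := hdeg v hv a
    exact ⟨c, hc, hvc, by simpa using hca⟩
  obtain ⟨B, ⟨hBN, hBc, ⟨e, heN, heB, b, hb, hbe⟩, hout⟩, hmax⟩ := (Set.toFinite P).exists_maximal hP
  by_contra hno
  have hnb : ∀ v ∈ N, v ∉ B → (∃ b ∈ B, G.Adj b v) → ¬ G.Adj v e := fun v hv hvB hbv hve =>
    hno ⟨B, v, e, hBN, hBc, hv, heN, hvB, heB, hve, hbv, b, hb, hbe⟩
  have hmem : insert e B ∈ P := by
    refine ⟨Set.insert_subset heN hBN, induce_insert_connected hBc hb hbe, ?_, ?_⟩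
    · obtain ⟨c, hc, hec, hcB⟩ := hout e heN heB ⟨b, hb, hbe⟩
      exact ⟨c, hc, by simp [hcB, hec.ne'], e, by simp, hec⟩
    · intro v hv hvB hbv
      have hvB' : v ∉ B := fun h => hvB (by simp [h])
      by_cases hadj : ∃ b ∈ B, G.Adj b v
      · obtain ⟨c, hc, hvc, hcB⟩ := hout v hv hvB' hadj
        have hce : c ≠ e := by
          rintro rfl
          exact hnb v hv hvB' hadj hvc
        exact ⟨c, hc, hvc, by simp [hcB, hce]⟩
      · obtain ⟨c, hc, hvc, hce⟩ := hdeg v hv e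
        have hcB : c ∉ B := fun h => hadj ⟨c, h, hvc.symm⟩
        exact ⟨c, hc, hvc, by simp [hcB, hce]⟩
  exact heB (hmax hmem (Set.subset_insert e B) (Set.mem_insert e B))

theorem hasK4Minor_of_branchSets {G : SimpleGraph V} {C B : Set V} {w w' : V}
    (hC : (G.induce C).Connected) (hB : (G.induce B).Connected)
    (hBN : ∀ b ∈ B, b ∉ C ∧ ∃ c ∈ C, G.Adj c b)
    (hwC : w ∉ C) (hwC' : w' ∉ C) (hwB : w ∉ B) (hwB' : w' ∉ B)
    (hww : G.Adj w w') (hCw : ∃ c ∈ C, G.Adj c w) (hCw' : ∃ c ∈ C, G.Adj c w')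
    (hBw : ∃ b ∈ B, G.Adj b w) (hBw' : ∃ b ∈ B, G.Adj b w') : HasK4Minor G := by
  have hCB : Disjoint C B := Set.disjoint_left.2 fun x hx hxB => (hBN x hxB).1 hx
  obtain ⟨⟨b, hb⟩⟩ := hB.nonempty
  obtain ⟨⟨c, hc⟩⟩ := hC.nonempty
  obtain ⟨-, c', hc', hcb⟩ := hBN b hb
  have hne : w ≠ w' := hww.ne
  let S : Fin 4 → Set V := ![C, B, {w}, {w'}]
  have hlt : ∀ i j, i < j → Disjoint (S i) (S j) ∧ ∃ u ∈ S i, ∃ v ∈ S j, G.Adj u v := by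
    have h01 : ∃ u ∈ C, ∃ v ∈ B, G.Adj u v := ⟨c', hc', b, hb, hcb⟩
    intro i j hij
    fin_cases i <;> fin_cases j <;> simp [S] at hij ⊢ <;> simp_all
  refine ⟨S, ?_, fun i j hij => ?_, ?_, fun i j hij => ?_⟩
  · intro i
    fin_cases i
    exacts [⟨c, hc⟩, ⟨b, hb⟩, ⟨w, rfl⟩, ⟨w', rfl⟩]
  · rcases lt_or_gt_of_ne hij with h | h
    · exact (hlt i j h).1
    · exact (hlt j i h).1.symm
  · intro i
    fin_cases i
    exacts [hC, hB, G.induce_singleton_connected w, G.induce_singleton_connected w']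
  · rcases lt_or_gt_of_ne hij with h | h
    · exact (hlt i j h).2
    · obtain ⟨u, hu, v, hv, huv⟩ := (hlt j i h).2
      exact ⟨v, hv, u, hu, huv.symm⟩

/-- A graph in which every vertex has at least three neighbors has a `K₄` minor. -/
theorem hasK4Minor_of_three_neighbors [Finite V] [Nonempty V] (G : SimpleGraph V)
    (hdeg : ∀ v a b, ∃ c, G.Adj v c ∧ c ≠ a ∧ c ≠ b) : HasK4Minor G := by
  -- Connected sets `C` such that, in `G / C`, all vertices other than `C` and one exceptional
  -- neighbor `e` of `C` still have degree at least three.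
  let P : Set (Set V) := {C | (G.induce C).Connected ∧
    ∃ e, e ∉ C ∧ (∃ c ∈ C, G.Adj c e) ∧ (∃ x, G.Adj e x ∧ x ∉ C) ∧
      ∀ v, v ∉ C → (∃ c ∈ C, G.Adj c v) → v ≠ e → ∀ a, ∃ x, G.Adj v x ∧ x ∉ C ∧ x ≠ a}
  have hP : P.Nonempty := by
    obtain ⟨a⟩ := ‹Nonempty V›
    obtain ⟨e, hae, -⟩ := hdeg a a a
    obtain ⟨x, hex, hxa, -⟩ := hdeg e a a
    refine ⟨{a}, G.induce_singleton_connected a, e, by simpa using hae.ne', ⟨a, rfl, hae⟩,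
      ⟨x, hex, by simpa using hxa⟩, fun v _ _ _ b => ?_⟩
    obtain ⟨c, hvc, hca, hcb⟩ := hdeg v a b
    exact ⟨c, hvc, by simpa using hca, hcb⟩
  obtain ⟨C, ⟨hC, e, heC, hCe, heout, hout⟩, hmax⟩ := (Set.toFinite P).exists_maximal hP
  have hstep : ∀ w, w ∉ C → (∃ c ∈ C, G.Adj c w) → (∃ x, G.Adj w x ∧ x ∉ C) →
      (∀ v, v ∉ C → (∃ c ∈ C, G.Adj c v) → v ≠ w → ∀ a, ∃ x, G.Adj v x ∧ x ∉ C ∧ x ≠ a) →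
      ∃ x y, x ≠ y ∧ G.Adj w x ∧ G.Adj w y ∧ x ∉ C ∧ y ∉ C ∧
        (∃ c ∈ C, G.Adj c x) ∧ ∃ c ∈ C, G.Adj c y := by
    intro w hwC ⟨c, hc, hcw⟩ hwout hnormal
    by_contra hno
    obtain ⟨f, hwf, hfC, hf⟩ : ∃ f, G.Adj w f ∧ f ∉ C ∧
        ∀ x, G.Adj w x → x ∉ C → (∃ c ∈ C, G.Adj c x) → x = f := by
      by_cases h : ∃ f, G.Adj w f ∧ f ∉ C ∧ ∃ c ∈ C, G.Adj c f
      · obtain ⟨f, hwf, hfC, hCf⟩ := h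
        refine ⟨f, hwf, hfC, fun x hwx hxC hCx => ?_⟩
        by_contra hxf
        exact hno ⟨x, f, hxf, hwx, hwf, hxC, hfC, hCx, hCf⟩
      · obtain ⟨f, hwf, hfC⟩ := hwout
        exact ⟨f, hwf, hfC, fun x hwx hxC hCx => (h ⟨x, hwx, hxC, hCx⟩).elim⟩
    have hfull : ∀ v, v ∉ C → ¬ (∃ c ∈ C, G.Adj c v) →
        ∀ a, ∃ x, G.Adj v x ∧ x ∉ insert w C ∧ x ≠ a := by
      intro v hvC hCv a
      obtain ⟨x, hvx, hxw, hxa⟩ := hdeg v w a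
      have hxC : x ∉ C := fun h => hCv ⟨x, h, hvx.symm⟩
      exact ⟨x, hvx, by simp [hxw, hxC], hxa⟩
    have hmem : insert w C ∈ P := by
      refine ⟨induce_insert_connected hC hc hcw, f, by simp [hwf.ne', hfC],
        ⟨w, by simp, hwf⟩, ?_, ?_⟩
      · by_cases hCf : ∃ c ∈ C, G.Adj c f
        · obtain ⟨x, hfx, hxC, hxw⟩ := hnormal f hfC hCf hwf.ne' w
          exact ⟨x, hfx, by simp [hxw, hxC]⟩
        · obtain ⟨x, hfx, hxC, -⟩ := hfull f hfC hCf w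
          exact ⟨x, hfx, hxC⟩
      · intro v hv _ hvf a
        simp only [Set.mem_insert_iff, not_or] at hv
        by_cases hCv : ∃ c ∈ C, G.Adj c v
        · obtain ⟨x, hvx, hxC, hxa⟩ := hnormal v hv.2 hCv hv.1 a
          have hxw : x ≠ w := by
            rintro rfl
            exact hvf (hf v hvx.symm hv.2 hCv)
          exact ⟨x, hvx, by simp [hxw, hxC], hxa⟩
        · exact hfull v hv.2 hCv a
    exact hwC (hmax hmem (Set.subset_insert w C) (Set.mem_insert w C))
  have hout' : ∀ v, v ∉ C → (∃ c ∈ C, G.Adj c v) → ∀ a, ∃ x, G.Adj v x ∧ x ∉ C ∧ x ≠ a := by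
    intro v hvC hCv a
    by_cases hve : v = e
    · subst hve
      obtain ⟨x, y, hxy, hvx, hvy, hxC, hyC, -, -⟩ := hstep v heC hCe heout hout
      by_cases hxa : x = a
      · exact ⟨y, hvy, hyC, hxa ▸ hxy.symm⟩
      · exact ⟨x, hvx, hxC, hxa⟩
    · exact hout v hvC hCv hve a
  obtain ⟨B, w, w', hBN, hB, hw, hw', hwB, hwB', hww, hBw, hBw'⟩ :=
    G.exists_triangle_branchSets (N := {v | v ∉ C ∧ ∃ c ∈ C, G.Adj c v}) ⟨e, heC, hCe⟩ (by
      rintro v ⟨hvC, hCv⟩ a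
      obtain ⟨z, hvz, hzC, -⟩ := hout' v hvC hCv v
      obtain ⟨x, y, hxy, hvx, hvy, hxC, hyC, hCx, hCy⟩ :=
        hstep v hvC hCv ⟨z, hvz, hzC⟩ fun u huC hCu _ => hout' u huC hCu
      by_cases hxa : x = a
      · exact ⟨y, ⟨hyC, hCy⟩, hvy, hxa ▸ hxy.symm⟩
      · exact ⟨x, ⟨hxC, hCx⟩, hvx, hxa⟩)
  exact hasK4Minor_of_branchSets hC hB hBN hw.1 hw'.1 hwB hwB' hww hw.2 hw'.2 hBw hBw'

/-- Contracting stars: `f` sends every vertex to the star it belongs to, and `g` sends a star to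
its center. -/
theorem hasK4Minor_of_star_contraction {G : SimpleGraph V} {H : SimpleGraph W} (f : V → W)
    (g : W → V) (hfg : ∀ x, f (g x) = x) (hstar : ∀ a, a = g (f a) ∨ G.Adj a (g (f a)))
    (hadj : ∀ x y, H.Adj x y → ∃ a b, f a = x ∧ f b = y ∧ G.Adj a b) (h : HasK4Minor H) :
    HasK4Minor G := by
  obtain ⟨S, hne, hdisj, hconn, hS⟩ := h
  refine ⟨fun i => f ⁻¹' S i, fun i => ?_, fun i j hij => (hdisj i j hij).preimage f,
    fun i => ?_, fun i j hij => ?_⟩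
  · obtain ⟨x, hx⟩ := hne i
    exact ⟨g x, by simpa [hfg] using hx⟩
  · have hcenter : ∀ a : f ⁻¹' S i, (G.induce (f ⁻¹' S i)).Reachable a
        ⟨g (f a), by rw [Set.mem_preimage, hfg]; exact a.2⟩ := by
      rintro ⟨a, ha⟩
      rcases hstar a with h | h
      · have : (⟨a, ha⟩ : f ⁻¹' S i) = ⟨g (f a), by simpa [hfg] using ha⟩ := Subtype.ext h
        rw [← this]
      · exact Adj.reachable (by simpa using h)
    have hreach : ∀ x y : S i, (H.induce (S i)).Walk x y → (G.induce (f ⁻¹' S i)).Reachable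
        ⟨g x, by simp [hfg]⟩ ⟨g y, by simp [hfg]⟩ := by
      intro x y p
      induction p with
      | nil => rfl
      | @cons x z y hxz _ ih =>
        obtain ⟨a, b, ha, hb, hab⟩ := hadj x z (by simpa using hxz)
        refine Reachable.trans ?_ ih
        have h1 := hcenter ⟨a, by simp [ha]⟩
        have h2 := hcenter ⟨b, by simp [hb]⟩
        simp only [ha, hb] at h1 h2
        exact h1.symm.trans (Reachable.trans (Adj.reachable (by simpa using hab)) h2)
    obtain ⟨x, hx⟩ := hne i
    have : Nonempty (f ⁻¹' S i) := ⟨⟨g x, by simpa [hfg] using hx⟩⟩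
    refine ⟨fun a b => ?_⟩
    obtain ⟨p⟩ := (hconn i).preconnected ⟨f a, a.2⟩ ⟨f b, b.2⟩
    exact ((hcenter a).trans (hreach _ _ p)).trans (hcenter b).symm
  · obtain ⟨x, hx, y, hy, hxy⟩ := hS i j hij
    obtain ⟨a, b, rfl, rfl, hab⟩ := hadj x y hxy
    exact ⟨a, hx, b, hy, hab⟩

/-- The graph obtained from `G` by suppressing all vertices of degree two. -/
def suppressDegreeTwo [Fintype V] (G : SimpleGraph V) [DecidableRel G.Adj] :
    SimpleGraph {v : V // G.degree v ≠ 2} where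
  Adj x y := x ≠ y ∧ (G.Adj x y ∨ ∃ s, G.degree s = 2 ∧ G.Adj s x ∧ G.Adj s y)
  symm := ⟨by
    rintro x y ⟨hxy, h | ⟨s, hs, hx, hy⟩⟩
    exacts [⟨hxy.symm, .inl h.symm⟩, ⟨hxy.symm, .inr ⟨s, hs, hy, hx⟩⟩]⟩
  loopless := ⟨fun x h => h.1 rfl⟩

theorem exists_neighborSet_eq_pair [Fintype V] {G : SimpleGraph V} [DecidableRel G.Adj]
    {s a : V} (hs : G.degree s = 2) (ha : G.Adj s a) :
    ∃ b, b ≠ a ∧ G.neighborSet s = {a, b} := by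
  classical
  obtain ⟨x, y, hxy, h⟩ := Finset.card_eq_two.1 hs
  have hset : G.neighborSet s = {x, y} := by
    rw [← coe_neighborFinset, h]
    simp
  have hmem : a ∈ ({x, y} : Set V) := hset ▸ ha
  rcases hmem with rfl | rfl
  · exact ⟨y, hxy.symm, hset⟩
  · exact ⟨x, hxy, by rw [hset, Set.pair_comm]⟩

theorem exists_third_neighbor [Fintype V] {G : SimpleGraph V} [DecidableRel G.Adj]
    {v : V} (hv : 2 < G.degree v) (a b : V) : ∃ c, G.Adj v c ∧ c ≠ a ∧ c ≠ b := by
  classical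
  obtain ⟨c, hc, hcab⟩ := Finset.exists_mem_notMem_of_card_lt_card
    (lt_of_le_of_lt (Finset.card_le_two (a := a) (b := b)) hv)
  simp only [Finset.mem_insert, Finset.mem_singleton, not_or] at hcab
  exact ⟨c, by simpa using hc, hcab⟩

theorem HasK4Minor.of_suppressDegreeTwo [Fintype V] {G : SimpleGraph V} [DecidableRel G.Adj]
    (hind : ∀ s t, G.degree s = 2 → G.Adj s t → G.degree t ≠ 2)
    (h : HasK4Minor G.suppressDegreeTwo) : HasK4Minor G := by
  classical
  have hnb : ∀ s, ∃ x : {v : V // G.degree v ≠ 2},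
      (G.degree s ≠ 2 → s = x) ∧ (G.degree s = 2 → G.Adj s x) := by
    intro s
    by_cases hs : G.degree s = 2
    · obtain ⟨a, ha⟩ := (G.degree_pos_iff_exists_adj s).1 (by omega)
      exact ⟨⟨a, hind s a hs ha⟩, fun h => (h hs).elim, fun _ => ha⟩
    · exact ⟨⟨s, hs⟩, fun _ => rfl, fun h => (hs h).elim⟩
  choose f hf1 hf2 using hnb
  have hfx : ∀ x : {v : V // G.degree v ≠ 2}, f x = x := fun x => Subtype.ext (hf1 x x.2).symm
  refine hasK4Minor_of_star_contraction f Subtype.val hfx (fun a => ?_) ?_ h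
  · by_cases ha : G.degree a = 2
    · exact .inr (hf2 a ha)
    · exact .inl (hf1 a ha)
  · rintro x y ⟨hxy, hadj | ⟨s, hs, hsx, hsy⟩⟩
    · exact ⟨x, y, hfx x, hfx y, hadj⟩
    · obtain ⟨b, -, hN⟩ := exists_neighborSet_eq_pair hs hsx
      have hfs : (f s : V) ∈ G.neighborSet s := hf2 s hs
      have hy : (y : V) ∈ G.neighborSet s := hsy
      rw [hN] at hfs hy
      have hyb : (y : V) = b := hy.resolve_left fun h => hxy (Subtype.ext h.symm)
      rcases hfs with h | h
      · exact ⟨s, y, Subtype.ext h, hfx y, hsy⟩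
      · exact ⟨x, s, hfx x, Subtype.ext (h.trans hyb.symm), hsx.symm⟩

end SimpleGraph


/-- **Lemma 6** (structural lemma): every non-null simple series-parallel graph
has (a) a vertex of degree at most one; (b) two distinct vertices of degree two
with the same neighbors; (c) distinct vertices `u, v` and not necessarily
distinct `w, z ∉ {u, v}` such that the neighbors of `v` are exactly `u` and `w`
and every neighbor of `u` is `v`, `w` or `z`; or (d) five distinct vertices
`v₁, v₂, u₁, u₂, w` such that the neighbors of `w` are exactly
`u₁, u₂, v₁, v₂` and the neighbors of `vᵢ` are exactly `w` and `uᵢ`. -/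
theorem seriesParallel_structure {V : Type} [Fintype V] [Nonempty V]
    (G : SimpleGraph V) [DecidableRel G.Adj] (hsp : SeriesParallel G) :
    (∃ v : V, G.degree v ≤ 1) ∨
    (∃ u v : V, u ≠ v ∧ G.degree u = 2 ∧ G.degree v = 2 ∧
      G.neighborSet u = G.neighborSet v) ∨
    (∃ u v w z : V, u ≠ v ∧ w ≠ u ∧ w ≠ v ∧ z ≠ u ∧ z ≠ v ∧
      G.neighborSet v = {u, w} ∧
      ∀ x : V, G.Adj u x → x = v ∨ x = w ∨ x = z) ∨
    (∃ v₁ v₂ u₁ u₂ w : V, ([v₁, v₂, u₁, u₂, w] : List V).Pairwise (· ≠ ·) ∧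
      G.neighborSet w = {u₁, u₂, v₁, v₂} ∧
      G.neighborSet v₁ = {w, u₁} ∧ G.neighborSet v₂ = {w, u₂}) := by
  classical
  by_contra hno
  simp only [not_or] at hno
  obtain ⟨ha, hb, hc, hd⟩ := hno
  have hdeg : ∀ v, 2 ≤ G.degree v := fun v => by
    by_contra hv
    exact ha ⟨v, by omega⟩
  have hthird : ∀ {v}, G.degree v ≠ 2 → ∀ a b, ∃ c, G.Adj v c ∧ c ≠ a ∧ c ≠ b := fun {v} hv =>
    SimpleGraph.exists_third_neighbor (lt_of_le_of_ne (hdeg v) hv.symm)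
  have hout : ∀ {u v w}, w ≠ u → G.neighborSet v = {u, w} → ∀ z, z ≠ u → z ≠ v →
      ∃ x, G.Adj u x ∧ x ≠ v ∧ x ≠ w ∧ x ≠ z := by
    intro u v w hwu hv z hzu hzv
    have hvu : G.Adj v u := by rw [← SimpleGraph.mem_neighborSet, hv]; simp
    have hvw : G.Adj v w := by rw [← SimpleGraph.mem_neighborSet, hv]; simp
    by_contra hx
    refine hc ⟨u, v, w, z, hvu.ne', hwu, hvw.ne', hzu, hzv, hv, fun x hux => ?_⟩
    by_contra hxne
    simp only [not_or] at hxne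
    exact hx ⟨x, hux, hxne⟩
  have hind : ∀ s t, G.degree s = 2 → G.Adj s t → G.degree t ≠ 2 := by
    intro s t hs hst ht
    obtain ⟨w, hwt, hw⟩ := SimpleGraph.exists_neighborSet_eq_pair hs hst
    obtain ⟨z, hzs, hz⟩ := SimpleGraph.exists_neighborSet_eq_pair ht hst.symm
    have htz : G.Adj t z := by rw [← SimpleGraph.mem_neighborSet, hz]; simp
    obtain ⟨x, hx, hxs, -, hxz⟩ := hout hwt hw z htz.ne' hzs
    rw [← SimpleGraph.mem_neighborSet, hz] at hx
    exact hx.elim hxs hxz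
  have huniq : ∀ s t x y, G.degree s = 2 → G.degree t = 2 → G.neighborSet s = {x, y} →
      G.neighborSet t = {x, y} → s = t := by
    intro s t x y hs ht hsN htN
    by_contra hst
    exact hb ⟨s, t, hst, hs, ht, hsN.trans htN.symm⟩
  have : Nonempty {v : V // G.degree v ≠ 2} := by
    obtain ⟨v⟩ := ‹Nonempty V›
    by_cases hv : G.degree v = 2
    · obtain ⟨a, hva⟩ := (G.degree_pos_iff_exists_adj v).1 (by omega)
      exact ⟨⟨a, hind v a hv hva⟩⟩
    · exact ⟨⟨v, hv⟩⟩
  obtain ⟨⟨w, hw⟩, p, q, hpq⟩ : ∃ w p q, ∀ c, G.suppressDegreeTwo.Adj w c → c = p ∨ c = q := by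
    by_contra hcon
    refine hsp (SimpleGraph.HasK4Minor.of_suppressDegreeTwo hind
      (SimpleGraph.hasK4Minor_of_three_neighbors _ fun v a b => ?_))
    by_contra hvab
    refine hcon ⟨v, a, b, fun c hvc => ?_⟩
    by_contra hcab
    simp only [not_or] at hcab
    exact hvab ⟨c, hvc, hcab⟩
  -- The neighbors of `w` of degree other than two are among `p` and `q`, and so is the second
  -- neighbor of each neighbor of `w` of degree two.
  have hdirect : ∀ a, G.Adj w a → G.degree a ≠ 2 → a = p ∨ a = q := by
    intro a hwa ha2
    simpa [Subtype.ext_iff] using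
      hpq ⟨a, ha2⟩ ⟨fun h => hwa.ne (congrArg Subtype.val h), .inl hwa⟩
  have hpath : ∀ s, G.Adj w s → G.degree s = 2 →
      ∃ b, b ≠ w ∧ G.degree b ≠ 2 ∧ (b = p ∨ b = q) ∧ G.neighborSet s = {w, b} := by
    intro s hws hs
    obtain ⟨b, hbw, hN⟩ := SimpleGraph.exists_neighborSet_eq_pair hs hws.symm
    have hsb : G.Adj s b := by rw [← SimpleGraph.mem_neighborSet, hN]; simp
    have hb2 := hind s b hs hsb
    refine ⟨b, hbw, hb2, ?_, hN⟩
    simpa [Subtype.ext_iff] using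
      hpq ⟨b, hb2⟩ ⟨fun h => hbw (congrArg Subtype.val h).symm, .inr ⟨s, hs, hws.symm, hsb⟩⟩
  obtain ⟨s, hws, hsp', hsq⟩ := hthird hw p q
  have hs : G.degree s = 2 := by
    by_contra hs
    exact (hdirect s hws hs).elim hsp' hsq
  obtain ⟨x, hxw, hx2, hxpq, hsN⟩ := hpath s hws hs
  obtain ⟨y, hy2, hxy⟩ : ∃ y, G.degree y ≠ 2 ∧ ∀ b, b = (p : V) ∨ b = q → b = x ∨ b = y := by
    rcases hxpq with rfl | rfl
    · exact ⟨q, q.2, fun b hb => hb⟩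
    · exact ⟨p, p.2, fun b hb => hb.symm⟩
  obtain ⟨t, hwt, hts, htx, hty⟩ : ∃ t, G.Adj w t ∧ t ≠ s ∧ t ≠ x ∧ t ≠ y := by
    by_cases hyw : y = w
    · obtain ⟨t, h1, h2, h3, -⟩ := hout hxw hsN x hxw (fun h => hx2 (h ▸ hs))
      exact ⟨t, h1, h2, h3, hyw ▸ h1.ne'⟩
    · exact hout hxw hsN y hyw (fun h => hy2 (h ▸ hs))
  have ht : G.degree t = 2 := by
    by_contra ht
    exact (hxy t (hdirect t hwt ht)).elim htx hty
  obtain ⟨b, hbw, hb2, hbpq, htN⟩ := hpath t hwt ht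
  have hbx : b ≠ x := by
    rintro rfl
    exact hts (huniq t s w b ht hs htN hsN)
  obtain rfl : b = y := (hxy b hbpq).resolve_left hbx
  have hnbr : ∀ a, G.Adj w a → a = x ∨ a = b ∨ a = s ∨ a = t := by
    intro a hwa
    by_cases ha2 : G.degree a = 2
    · obtain ⟨c, -, -, hcpq, haN⟩ := hpath a hwa ha2
      rcases hxy c hcpq with rfl | rfl
      · exact .inr (.inr (.inl (huniq a s w c ha2 hs haN hsN)))
      · exact .inr (.inr (.inr (huniq a t w c ha2 ht haN htN)))
    · exact (hxy a (hdirect a hwa ha2)).imp_right .inl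
  have hwb : G.Adj w b := by
    obtain ⟨a, hwa, has, hax, hat⟩ := hout hxw hsN t hwt.ne' hts
    rcases hnbr a hwa with h | rfl | h | h
    exacts [(hax h).elim, hwa, (has h).elim, (hat h).elim]
  have hwx : G.Adj w x := by
    obtain ⟨a, hwa, hat, hab, has⟩ := hout hbw htN s hws.ne' hts.symm
    rcases hnbr a hwa with rfl | h | h | h
    exacts [hwa, (hab h).elim, (has h).elim, (hat h).elim]
  refine hd ⟨s, t, x, b, w, ?_, ?_, hsN, htN⟩
  · have hsx : s ≠ x := fun h => hx2 (h ▸ hs)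
    have hsb : s ≠ b := fun h => hb2 (h ▸ hs)
    simp [hts.symm, hsx, hsb, hws.ne', htx, hty, hwt.ne', hbx.symm, hxw, hbw]
  · ext a
    simp only [SimpleGraph.mem_neighborSet, Set.mem_insert_iff, Set.mem_singleton_iff]
    refine ⟨hnbr a, ?_⟩
    rintro (rfl | rfl | rfl | rfl) <;> assumption
end

section
/- Every non-null simple series-parallel graph has a vertex of degree at most two. Equivalently, every simple graph in which every vertex has degree at least three contains a subdivision of K₄ as a subgraph (equivalently, has a K₄ minor). -/
open Finset

/-- If the vertices of `H` are modelled by disjoint nonempty connected branch sets of `G` and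
adjacent vertices of `H` have branch sets joined by an edge, a `K₄` minor of `H` lifts to `G`. -/
theorem HasK4Minor.of_branch_sets {V W : Type} {G : SimpleGraph V} {H : SimpleGraph W}
    (B : W → Set V) (hconn : ∀ x, (G.induce (B x)).Connected)
    (hdisj : ∀ x y, x ≠ y → Disjoint (B x) (B y))
    (hadj : ∀ x y, H.Adj x y → ∃ u ∈ B x, ∃ w ∈ B y, G.Adj u w)
    (h : HasK4Minor H) : HasK4Minor G := by
  obtain ⟨S, hne, hSdisj, hSconn, hSadj⟩ := h
  have hB : ∀ x, (B x).Nonempty := fun x ↦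
    let ⟨p⟩ := (hconn x).nonempty
    ⟨p.1, p.2⟩
  refine ⟨fun i ↦ ⋃ x ∈ S i, B x, fun i ↦ ?_, fun i j hij ↦ ?_, fun i ↦ ?_, fun i j hij ↦ ?_⟩
  · obtain ⟨x, hx⟩ := hne i
    obtain ⟨u, hu⟩ := hB x
    exact ⟨u, Set.mem_biUnion hx hu⟩
  · simp only [Set.disjoint_iUnion_left, Set.disjoint_iUnion_right]
    intro x hx y hy
    exact hdisj _ _ fun e ↦ Set.disjoint_left.1 (hSdisj i j hij) (e ▸ hy) (e ▸ hx)
  · have hsub : ∀ x ∈ S i, B x ⊆ ⋃ x ∈ S i, B x := fun x hx ↦ Set.subset_biUnion_of_mem hx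
    have hin : ∀ x (hx : x ∈ S i) u (hu : u ∈ B x) w (hw : w ∈ B x),
        (G.induce (⋃ x ∈ S i, B x)).Reachable ⟨u, hsub x hx hu⟩ ⟨w, hsub x hx hw⟩ :=
      fun x hx u hu w hw ↦ ((hconn x).preconnected ⟨u, hu⟩ ⟨w, hw⟩).map
        (G.induceHomOfLE (hsub x hx)).toHom
    have key : ∀ x y : S i, (H.induce (S i)).Reachable x y → ∀ u (hu : u ∈ B x) w (hw : w ∈ B y),
        (G.induce (⋃ x ∈ S i, B x)).Reachable ⟨u, hsub x x.2 hu⟩ ⟨w, hsub y y.2 hw⟩ := by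
      intro x y hxy u hu
      rw [SimpleGraph.reachable_iff_reflTransGen] at hxy
      induction hxy with
      | refl => exact fun w hw ↦ hin x x.2 u hu w hw
      | @tail y z _ hyz ih =>
        intro w hw
        obtain ⟨e, he, e', he', hee⟩ := hadj _ _ hyz
        have hstep : (G.induce (⋃ x ∈ S i, B x)).Adj ⟨e, hsub y y.2 he⟩ ⟨e', hsub z z.2 he'⟩ := hee
        exact ((ih e he).trans hstep.reachable).trans (hin z z.2 e' he' w hw)
    rw [SimpleGraph.connected_iff]
    refine ⟨?_, ?_⟩
    · rintro ⟨u, hu⟩ ⟨w, hw⟩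
      obtain ⟨x, hx, hux⟩ := Set.mem_iUnion₂.1 hu
      obtain ⟨y, hy, hwy⟩ := Set.mem_iUnion₂.1 hw
      exact key ⟨x, hx⟩ ⟨y, hy⟩ ((hSconn i).preconnected _ _) u hux w hwy
    · obtain ⟨x, hx⟩ := hne i
      obtain ⟨u, hu⟩ := hB x
      exact ⟨⟨u, hsub x hx hu⟩⟩
  · obtain ⟨x, hx, y, hy, hxy⟩ := hSadj i j hij
    obtain ⟨u, hu, w, hw, huw⟩ := hadj x y hxy
    exact ⟨u, Set.mem_biUnion hx hu, w, Set.mem_biUnion hy hw, huw⟩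

/-- Four pairwise adjacent vertices form a `K₄` minor. -/
theorem HasK4Minor.of_adj {V : Type} {G : SimpleGraph V} {a b c d : V} (hab : G.Adj a b)
    (hac : G.Adj a c) (had : G.Adj a d) (hbc : G.Adj b c) (hbd : G.Adj b d) (hcd : G.Adj c d) :
    HasK4Minor G := by
  have key : ∀ i j : Fin 4, i ≠ j → G.Adj (![a, b, c, d] i) (![a, b, c, d] j) := by
    intro i j hij
    fin_cases i <;> fin_cases j <;> simp_all [SimpleGraph.adj_comm]
  refine ⟨fun i ↦ {![a, b, c, d] i}, fun i ↦ Set.singleton_nonempty _, fun i j hij ↦ ?_,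
    fun i ↦ ?_, fun i j hij ↦ ⟨_, rfl, _, rfl, key i j hij⟩⟩
  · exact Set.disjoint_singleton.2 (key i j hij).ne
  · exact SimpleGraph.connected_iff _ |>.2 ⟨.of_subsingleton, inferInstance⟩

/-- The graph on `V` obtained from `G` by giving `a` all neighbours of `v` as well. -/
def absorbNeighbors {V : Type} (G : SimpleGraph V) (v a : V) : SimpleGraph V where
  Adj x y := x ≠ y ∧ (G.Adj x y ∨ (x = a ∧ G.Adj v y) ∨ (y = a ∧ G.Adj v x))
  symm := ⟨fun x y h ↦ ⟨h.1.symm, by have := G.adj_comm x y; tauto⟩⟩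
  loopless := ⟨fun x h ↦ h.1 rfl⟩

/-- Contracting the edge `va` onto `a` and deleting further vertices does not create `K₄` minors. -/
theorem HasK4Minor.of_absorbNeighbors {V : Type} {G : SimpleGraph V} {v a : V} (hva : G.Adj v a)
    (s : Set V) (hv : v ∉ s) (h : HasK4Minor ((absorbNeighbors G v a).induce s)) :
    HasK4Minor G := by
  classical
  refine h.of_branch_sets (fun x ↦ if x.1 = a then {v, a} else {x.1}) (fun x ↦ ?_)
    (fun x y hxy ↦ ?_) fun x y hxy ↦ ?_
  · by_cases hx : x.1 = a
    · rw [if_pos hx]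
      exact SimpleGraph.induce_pair_connected_of_adj hva
    · rw [if_neg hx]
      exact SimpleGraph.connected_iff _ |>.2 ⟨.of_subsingleton, inferInstance⟩
  · have hx := x.2
    have hy := y.2
    have hne : x.1 ≠ y.1 := fun e ↦ hxy (Subtype.ext e)
    rw [Set.disjoint_left]
    split_ifs <;> simp <;> grind
  · obtain ⟨hne, hxy⟩ := hxy
    simp only [Function.Embedding.subtype_apply] at hne hxy
    have hmem : ∀ z : s, z.1 ∈ (if z.1 = a then {v, a} else {z.1} : Set V) := by
      intro z
      split_ifs with hz <;> simp [hz]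
    rcases hxy with hxy | ⟨hx, hxy⟩ | ⟨hy, hxy⟩
    · exact ⟨_, hmem x, _, hmem y, hxy⟩
    · exact ⟨v, by simp [hx], _, hmem y, hxy⟩
    · exact ⟨_, hmem x, v, by simp [hy], hxy.symm⟩

/-- The vertex `x` has at least three neighbours: one of them avoids any two given vertices. -/
def HasThreeNeighbors {V : Type} (G : SimpleGraph V) (x : V) : Prop :=
  ∀ p q, ∃ r, G.Adj x r ∧ r ≠ p ∧ r ≠ q

/-- The vertex `x` has at least four neighbours: one of them avoids any three given vertices. -/
def HasFourNeighbors {V : Type} (G : SimpleGraph V) (x : V) : Prop :=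
  ∀ p q t, ∃ r, G.Adj x r ∧ r ≠ p ∧ r ≠ q ∧ r ≠ t

theorem hasThreeNeighbors_of_le_degree {V : Type} [Fintype V] {G : SimpleGraph V}
    [DecidableRel G.Adj] {x : V} (h : 3 ≤ G.degree x) : HasThreeNeighbors G x := by
  classical
  intro p q
  have hlt : #({p, q} : Finset V) < #(G.neighborFinset x) :=
    card_le_two.trans_lt (by rw [G.card_neighborFinset_eq_degree]; omega)
  obtain ⟨r, hr, hr'⟩ := exists_mem_notMem_of_card_lt_card hlt
  exact ⟨r, by simpa using hr, by simp_all⟩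

/-- If all neighbours of `x` lie in `{p, q, t}`, then `p`, `q`, `t` are distinct neighbours. -/
theorem HasThreeNeighbors.eq_of_forall {V : Type} {G : SimpleGraph V} {x p q t : V}
    (hx : HasThreeNeighbors G x) (h : ∀ r, G.Adj x r → r = p ∨ r = q ∨ r = t) :
    (G.Adj x p ∧ G.Adj x q ∧ G.Adj x t) ∧ p ≠ q ∧ p ≠ t ∧ q ≠ t := by
  obtain ⟨r₁, h₁⟩ := hx p q
  obtain ⟨r₂, h₂⟩ := hx p t
  obtain ⟨r₃, h₃⟩ := hx q t
  have := h r₁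
  have := h r₂
  have := h r₃
  clear hx h
  grind

theorem exists_of_not_hasFourNeighbors {V : Type} {G : SimpleGraph V} {x : V}
    (h : ¬ HasFourNeighbors G x) : ∃ p q t, ∀ r, G.Adj x r → r = p ∨ r = q ∨ r = t := by
  unfold HasFourNeighbors at h
  push Not at h
  obtain ⟨p, q, t, h⟩ := h
  exact ⟨p, q, t, fun r hr ↦ by have := h r hr; tauto⟩

/-- A graph of minimum degree at least three without `K₄` minor, such that all nonempty graphs of
minimum degree at least three on fewer vertices have a `K₄` minor. -/
structure IsMinimalCounterexample {V : Type} (G : SimpleGraph V) : Prop where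
  three : ∀ x, HasThreeNeighbors G x
  not_minor : ¬ HasK4Minor G
  minimal : ∀ (W : Type) [Finite W] [Nonempty W] (H : SimpleGraph W), Nat.card W < Nat.card V →
    (∀ x, HasThreeNeighbors H x) → HasK4Minor H

namespace IsMinimalCounterexample

variable {V : Type} [Finite V] {G : SimpleGraph V}

theorem not_reducible (hG : IsMinimalCounterexample G) {v a : V} (hva : G.Adj v a) (s : Set V)
    (hv : v ∉ s) (ha : a ∈ s)
    (hs : ∀ x ∈ s, ∀ p q, ∃ r ∈ s, (absorbNeighbors G v a).Adj x r ∧ r ≠ p ∧ r ≠ q) : False := by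
  have : Nonempty s := ⟨⟨a, ha⟩⟩
  refine hG.not_minor (.of_absorbNeighbors hva s hv (hG.minimal s _ ?_ ?_))
  · exact Finite.card_subtype_lt hv
  · intro x p q
    obtain ⟨r, hr, h₁, h₂, h₃⟩ := hs x x.2 p q
    exact ⟨⟨r, hr⟩, h₁, fun e ↦ h₂ (congrArg Subtype.val e), fun e ↦ h₃ (congrArg Subtype.val e)⟩

/-- No edge of a minimal counterexample can be contracted keeping minimum degree three. -/
theorem not_contractible (hG : IsMinimalCounterexample G) {v a : V} (hva : G.Adj v a)
    (hcommon : ∀ x, G.Adj x v → G.Adj x a → HasFourNeighbors G x)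
    (hnew : ∀ p q, ∃ r, (G.Adj a r ∨ G.Adj v r) ∧ r ≠ v ∧ r ≠ a ∧ r ≠ p ∧ r ≠ q) : False := by
  refine hG.not_reducible hva {x | x ≠ v} (by simp) hva.ne' fun x (hx : x ≠ v) p q ↦ ?_
  change ∃ r, r ≠ v ∧ (x ≠ r ∧ (G.Adj x r ∨ (x = a ∧ G.Adj v r) ∨ (r = a ∧ G.Adj v x))) ∧ _
  by_cases hxa : x = a
  · obtain ⟨r, h⟩ := hnew p q
    exact ⟨r, by clear hcommon hnew; grind⟩
  by_cases hxv : G.Adj x v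
  · by_cases hxa' : G.Adj x a
    · obtain ⟨r, h⟩ := hcommon x hxv hxa' p q v
      exact ⟨r, by have := h.1.ne; tauto⟩
    · by_cases hp : a = p
      · obtain ⟨r, h⟩ := hG.three x v q
        exact ⟨r, by have := h.1.ne; clear hcommon hnew; grind⟩
      by_cases hq : a = q
      · obtain ⟨r, h⟩ := hG.three x v p
        exact ⟨r, by have := h.1.ne; clear hcommon hnew; grind⟩
      · exact ⟨a, hva.ne', ⟨hxa, .inr (.inr ⟨rfl, hxv.symm⟩)⟩, hp, hq⟩
  · obtain ⟨r, h⟩ := hG.three x p q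
    exact ⟨r, by have := h.1.ne; clear hcommon hnew; grind⟩

/-- Each edge of a minimal counterexample lies in a triangle. -/
theorem exists_common_neighbor (hG : IsMinimalCounterexample G) {v a : V} (hva : G.Adj v a) :
    ∃ x, G.Adj x v ∧ G.Adj x a := by
  by_contra! hno
  refine hG.not_contractible hva (fun x h₁ h₂ ↦ absurd h₂ (hno x h₁)) fun p q ↦ ?_
  by_contra! hall
  have hall_a : ∀ r, G.Adj a r → r = v ∨ r = p ∨ r = q := fun r hr ↦ by
    have := hall r (.inl hr)
    have := hr.ne'
    tauto
  have hall_v : ∀ r, G.Adj v r → r = a ∨ r = p ∨ r = q := fun r hr ↦ by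
    have := hall r (.inr hr)
    have := hr.ne'
    tauto
  obtain ⟨⟨-, hap, -⟩, -⟩ := (hG.three a).eq_of_forall hall_a
  obtain ⟨⟨-, hvp, -⟩, -⟩ := (hG.three v).eq_of_forall hall_v
  exact hno p hvp.symm hap.symm

theorem exists_not_hasFourNeighbors [Nonempty V] (hG : IsMinimalCounterexample G) :
    ∃ v, ¬ HasFourNeighbors G v := by
  by_contra! hall
  obtain ⟨v⟩ := ‹Nonempty V›
  obtain ⟨a, hva, -⟩ := hG.three v v v
  refine hG.not_contractible hva (fun x _ _ ↦ hall x) fun p q ↦ ?_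
  obtain ⟨r, h⟩ := hall a p q v
  exact ⟨r, .inl h.1, h.2.2.2, h.1.ne', h.2.1, h.2.2.1⟩

/-- An end of a diamond with middle vertices `v`, `b` of degree three has degree at least four. -/
theorem hasFourNeighbors_of_diamond (hG : IsMinimalCounterexample G) {v b x y : V}
    (hvx : G.Adj v x) (hbx : G.Adj b x) (hxy : ¬ G.Adj x y)
    (hv : ∀ r, G.Adj v r → r = x ∨ r = b ∨ r = y) (hb : ∀ r, G.Adj b r → r = x ∨ r = v ∨ r = y) :
    HasFourNeighbors G x := by
  by_contra hx
  obtain ⟨p, q, t, hx⟩ := exists_of_not_hasFourNeighbors hx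
  obtain ⟨z, hz, hzv, hzb⟩ := hG.three x v b
  obtain ⟨w, hwx, hwz⟩ := hG.exists_common_neighbor hz
  have hzx := hz.ne'
  have hwx' := hwx.ne
  have hwz' := hwz.ne
  have hvb : v ≠ b := fun e ↦ by
    subst e
    obtain ⟨r, hr, h₁, h₂⟩ := hG.three v x y
    have := hb r hr
    have := hr.ne'
    tauto
  have hw : w = v ∨ w = b := by
    have h₁ := hx v hvx.symm
    have h₂ := hx b hbx.symm
    have h₃ := hx z hz
    have h₄ := hx w hwx.symm
    clear hx hv hb
    grind
  rcases hw with rfl | rfl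
  · have := hv z hwz
    clear hx hv hb
    grind
  · have := hb z hwz
    clear hx hv hb
    grind

/-- A minimal counterexample has no diamond with middle vertices of degree three. -/
theorem not_diamond (hG : IsMinimalCounterexample G) {v a b c : V} (hac : ¬ G.Adj a c)
    (hNv : ∀ r, G.Adj v r → r = a ∨ r = b ∨ r = c)
    (hNb : ∀ r, G.Adj b r → r = a ∨ r = v ∨ r = c) : False := by
  obtain ⟨⟨hva, hvb, hvc⟩, hab', hac', hbc'⟩ := (hG.three v).eq_of_forall hNv
  obtain ⟨⟨hba, -, hbc⟩, -⟩ := (hG.three b).eq_of_forall hNb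
  have hva' := hva.ne
  have hvb' := hvb.ne
  have hvc' := hvc.ne
  have ha := hG.hasFourNeighbors_of_diamond hva hba hac hNv hNb
  have hc := hG.hasFourNeighbors_of_diamond (y := a) hvc hbc (fun h ↦ hac h.symm)
    (fun r hr ↦ by have := hNv r hr; tauto) (fun r hr ↦ by have := hNb r hr; tauto)
  refine hG.not_reducible hva {x | x ≠ v ∧ x ≠ b} (by simp) ⟨hva.ne', hab'⟩
    fun x (hx : x ≠ v ∧ x ≠ b) p q ↦ ?_
  change ∃ r, (r ≠ v ∧ r ≠ b) ∧
    (x ≠ r ∧ (G.Adj x r ∨ (x = a ∧ G.Adj v r) ∨ (r = a ∧ G.Adj v x))) ∧ _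
  have hend : ∀ y z, HasFourNeighbors G y → ¬ G.Adj y z → ∀ p q, z = p ∨ z = q →
      ∃ r, G.Adj y r ∧ r ≠ v ∧ r ≠ b ∧ r ≠ p ∧ r ≠ q := by
    rintro y z hy hyz p q (rfl | rfl)
    · obtain ⟨r, hr, h₁, h₂, h₃⟩ := hy v b q
      exact ⟨r, hr, h₁, h₂, fun e ↦ hyz (e ▸ hr), h₃⟩
    · obtain ⟨r, hr, h₁, h₂, h₃⟩ := hy v b p
      exact ⟨r, hr, h₁, h₂, h₃, fun e ↦ hyz (e ▸ hr)⟩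
  by_cases hxa : x = a
  · subst hxa
    by_cases hpq : c = p ∨ c = q
    · obtain ⟨r, h⟩ := hend x c ha hac p q hpq
      exact ⟨r, by have := h.1.ne; tauto⟩
    · exact ⟨c, by tauto⟩
  by_cases hxc : x = c
  · subst hxc
    by_cases hpq : a = p ∨ a = q
    · obtain ⟨r, h⟩ := hend x a hc (fun h ↦ hac h.symm) p q hpq
      exact ⟨r, by have := h.1.ne; tauto⟩
    · exact ⟨a, by tauto⟩
  obtain ⟨r, hr, h⟩ := hG.three x p q
  refine ⟨r, ⟨?_, ?_⟩, ⟨hr.ne, .inl hr⟩, h⟩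
  · rintro rfl
    have := hNv x hr.symm
    tauto
  · rintro rfl
    have := hNb x hr.symm
    tauto

/-- The neighbours `a`, `b`, `c` of a vertex of degree three do not form a path. -/
theorem not_path (hG : IsMinimalCounterexample G) {v a b c : V}
    (hN : ∀ r, G.Adj v r → r = a ∨ r = b ∨ r = c) (hab : G.Adj a b) (hbc : G.Adj b c) : False := by
  obtain ⟨⟨hva, hvb, hvc⟩, hab', hac', hbc'⟩ := (hG.three v).eq_of_forall hN
  by_cases hac : G.Adj a c
  · exact hG.not_minor (.of_adj hva hvb hvc hab hac hbc)
  by_cases hb : HasFourNeighbors G b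
  · refine hG.not_contractible hva (fun x h₁ h₂ ↦ ?_) fun p q ↦ ?_
    · rcases hN x h₁.symm with rfl | rfl | rfl
      · exact absurd rfl h₂.ne
      · exact hb
      · exact absurd h₂.symm hac
    · obtain ⟨r, hr, hrv, hrb⟩ := hG.three a v b
      by_contra! hall
      have h₁ := hall r (.inl hr) hrv hr.ne'
      have h₂ := hall b (.inr hvb) hvb.ne' hab'.symm
      have h₃ := hall c (.inr hvc) hvc.ne' hac'.symm
      have hrc : r ≠ c := fun e ↦ hac (e ▸ hr)
      clear hall hN
      by_cases hbp : b = p <;> by_cases hcp : c = p <;> grind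
  · obtain ⟨p, q, t, hb⟩ := exists_of_not_hasFourNeighbors hb
    refine hG.not_diamond hac hN fun r hr ↦ ?_
    have h₁ := hb a hab.symm
    have h₂ := hb v hvb.symm
    have h₃ := hb c hbc
    have h₄ := hb r hr
    have := hva.ne
    have := hvc.ne
    clear hb hN
    grind

end IsMinimalCounterexample

theorem not_isMinimalCounterexample {V : Type} [Finite V] [Nonempty V] (G : SimpleGraph V) :
    ¬ IsMinimalCounterexample G := by
  intro hG
  obtain ⟨v, hv⟩ := hG.exists_not_hasFourNeighbors
  obtain ⟨a, b, c, hN⟩ := exists_of_not_hasFourNeighbors hv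
  obtain ⟨⟨hva, hvb, hvc⟩, -⟩ := (hG.three v).eq_of_forall hN
  have hpath : ∀ x y z, G.Adj x y → G.Adj y z →
      ¬ ∀ r, G.Adj v r → r = x ∨ r = y ∨ r = z := fun _ _ _ hxy hyz h ↦ hG.not_path h hxy hyz
  have h₁ : G.Adj a b → ¬ G.Adj b c := fun h h' ↦ hpath a b c h h' hN
  have h₂ : G.Adj a b → ¬ G.Adj a c := fun h h' ↦
    hpath b a c h.symm h' fun r hr ↦ by have := hN r hr; tauto
  have h₃ : G.Adj a c → ¬ G.Adj b c := fun h h' ↦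
    hpath a c b h h'.symm fun r hr ↦ by have := hN r hr; tauto
  have hnbr : ∀ w, G.Adj v w → G.Adj a w ∨ G.Adj b w ∨ G.Adj c w := fun w hw ↦ by
    obtain ⟨x, hxv, hxw⟩ := hG.exists_common_neighbor hw
    rcases hN x hxv.symm with rfl | rfl | rfl <;> tauto
  have ha := hnbr a hva
  have hb := hnbr b hvb
  have hc := hnbr c hvc
  simp only [SimpleGraph.irrefl, G.adj_comm b a, G.adj_comm c a, G.adj_comm c b] at ha hb hc
  tauto

/-- A nonempty finite graph of minimum degree at least three has a `K₄` minor. -/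
theorem hasK4Minor_of_forall_hasThreeNeighbors (n : ℕ) : ∀ (V : Type) [Finite V] [Nonempty V]
    (G : SimpleGraph V), Nat.card V = n → (∀ x, HasThreeNeighbors G x) → HasK4Minor G := by
  induction n using Nat.strong_induction_on with
  | _ n ih =>
    intro V _ _ G hn hdeg
    by_contra hK
    exact not_isMinimalCounterexample G
      ⟨hdeg, hK, fun W _ _ H hW ↦ ih _ (hn ▸ hW) W H rfl⟩

/-- Every non-null simple series-parallel graph has a vertex of degree at most
two; equivalently, every simple graph in which every vertex has degree at least
three has a `K₄` minor (equivalently, contains a subdivision of `K₄`). -/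
theorem seriesParallel_min_degree :
    (∀ (V : Type) [Fintype V] [Nonempty V] (G : SimpleGraph V)
      [DecidableRel G.Adj], SeriesParallel G → ∃ v : V, G.degree v ≤ 2) ∧
    (∀ (V : Type) [Fintype V] [Nonempty V] (G : SimpleGraph V)
      [DecidableRel G.Adj], (∀ v : V, 3 ≤ G.degree v) → HasK4Minor G) := by
  have key : ∀ (V : Type) [Fintype V] [Nonempty V] (G : SimpleGraph V) [DecidableRel G.Adj],
      (∀ v : V, 3 ≤ G.degree v) → HasK4Minor G := fun V _ _ G _ h ↦
    hasK4Minor_of_forall_hasThreeNeighbors _ V G rfl fun x ↦ hasThreeNeighbors_of_le_degree (h x)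
  refine ⟨fun V _ _ G _ h ↦ ?_, key⟩
  by_contra! hdeg
  exact h (key V G hdeg)
end
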